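/- arXiv:math/0306080 — 3 statements merged into one kernel-verified Lean document; each statement's English description precedes it below -/
import Mathlib

section
/- Let M be a Hausdorff topological space and let γ ∈ LM = C(S¹, M). The isotropy subgroup Is(γ) = {θ ∈ S¹ | θ • γ = γ} of γ under the reparametrization action equals the whole circle S¹ if and only if γ is a constant map; and if γ is not constant then Is(γ) is a finite cyclic subgroup of S¹. -/
/-- The reparametrization action of the circle on the free loop space
`LM = C(S¹, M)`: `(θ • γ) t = γ (t * θ)`. -/
noncomputable instance loopSMul (M : Type*) [TopologicalSpace M] :
    SMul Circle C(Circle, M) :=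
  ⟨fun θ γ => γ.comp ⟨fun t => t * θ, by continuity⟩⟩

@[simp] lemma loopSMul_apply {M : Type*} [TopologicalSpace M]
    (θ : Circle) (γ : C(Circle, M)) (t : Circle) : (θ • γ) t = γ (t * θ) := rfl

/-- The reparametrization action is a group action. -/
noncomputable instance loopMulAction (M : Type*) [TopologicalSpace M] :
    MulAction Circle C(Circle, M) where
  one_smul γ := by ext t; simp
  mul_smul θ θ' γ := by ext t; simp [mul_assoc, mul_comm θ θ']

/-- A proper closed subgroup of the circle is generated by an element of finite order. -/
theorem Circle.exists_isOfFinOrder_eq_zpowers_of_isClosed {H : Subgroup Circle}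
    (hH : IsClosed (H : Set Circle)) (hne : H ≠ ⊤) :
    ∃ z : Circle, IsOfFinOrder z ∧ H = Subgroup.zpowers z := by
  have hsurj : Function.Surjective (AddCircle.toCircle (T := (1 : ℝ))) := fun z => by
    obtain ⟨x, rfl⟩ := (AddCircle.homeomorphCircle (one_ne_zero (α := ℝ))).surjective z
    exact ⟨x, (AddCircle.homeomorphCircle_apply one_ne_zero x).symm⟩
  let s : AddSubgroup (AddCircle (1 : ℝ)) :=
    { carrier := AddCircle.toCircle ⁻¹' H
      zero_mem' := by simp [H.one_mem]
      add_mem' := fun {x y} hx hy => by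
        simpa [AddCircle.toCircle_add] using H.mul_mem hx hy
      neg_mem' := fun {x} hx => by
        simpa [AddCircle.toCircle_neg] using H.inv_mem hx }
  have hmem : ∀ x, x ∈ s ↔ AddCircle.toCircle x ∈ H := fun _ => Iff.rfl
  have hs : IsClosed (s : Set (AddCircle (1 : ℝ))) := hH.preimage AddCircle.continuous_toCircle
  have hdense : ¬ Dense (s : Set (AddCircle (1 : ℝ))) := fun hd => by
    refine hne ((Subgroup.eq_top_iff' H).2 fun z => ?_)
    obtain ⟨x, rfl⟩ := hsurj z
    have hx := hd x
    rwa [hs.closure_eq] at hx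
  rw [AddCircle.dense_addSubgroup_iff_ne_zmultiples] at hdense
  push Not at hdense
  obtain ⟨a, ha, hsa⟩ := hdense
  refine ⟨AddCircle.toCircle a, isOfFinOrder_iff_pow_eq_one.2
    ⟨addOrderOf a, Nat.pos_of_ne_zero ha, ?_⟩, ?_⟩
  · rw [← AddCircle.toCircle_nsmul, addOrderOf_nsmul_eq_zero, AddCircle.toCircle_zero]
  · ext z
    obtain ⟨x, rfl⟩ := hsurj z
    simp_rw [← hmem, hsa, AddSubgroup.mem_zmultiples_iff, Subgroup.mem_zpowers_iff,
      ← AddCircle.toCircle_zsmul, (AddCircle.injective_toCircle (one_ne_zero (α := ℝ))).eq_iff]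

/-- The isotropy group of a loop in a Hausdorff space is closed. -/
theorem isClosed_stabilizer_loop {M : Type*} [TopologicalSpace M] [T2Space M]
    (γ : C(Circle, M)) : IsClosed (MulAction.stabilizer Circle γ : Set Circle) := by
  have h : (MulAction.stabilizer Circle γ : Set Circle) =
      ⋂ t : Circle, {θ | γ (t * θ) = γ t} := by
    ext θ
    simp [MulAction.mem_stabilizer_iff, ContinuousMap.ext_iff]
  rw [h]
  exact isClosed_iInter fun t => isClosed_eq (by fun_prop) continuous_const

theorem stabilizer_loop_eq_top_iff {M : Type*} [TopologicalSpace M] (γ : C(Circle, M)) :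
    MulAction.stabilizer Circle γ = ⊤ ↔ ∃ m : M, γ = ContinuousMap.const Circle m := by
  constructor
  · intro h
    refine ⟨γ 1, ContinuousMap.ext fun t => ?_⟩
    have ht : t • γ = γ := by
      rw [← MulAction.mem_stabilizer_iff, h]
      exact Subgroup.mem_top t
    simpa using DFunLike.congr_fun ht 1
  · rintro ⟨m, rfl⟩
    refine (Subgroup.eq_top_iff' _).2 fun θ => ?_
    rw [MulAction.mem_stabilizer_iff]
    ext t
    simp

/-- For a loop `γ` in a Hausdorff space `M`, the isotropy subgroup
`Is(γ) = {θ ∈ S¹ | θ • γ = γ}` of the reparametrization action is the whole circle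
iff `γ` is constant, and otherwise it is a finite cyclic subgroup of `S¹`. -/
theorem isotropy_eq_top_iff_const_and_finite_cyclic (M : Type*) [TopologicalSpace M]
    [T2Space M] (γ : C(Circle, M)) :
    (MulAction.stabilizer Circle γ = ⊤ ↔ ∃ m : M, γ = ContinuousMap.const Circle m) ∧
      ((¬ ∃ m : M, γ = ContinuousMap.const Circle m) →
        Finite (MulAction.stabilizer Circle γ) ∧
          IsCyclic (MulAction.stabilizer Circle γ)) := by
  refine ⟨stabilizer_loop_eq_top_iff γ, fun hγ => ?_⟩
  obtain ⟨z, hz, h⟩ := Circle.exists_isOfFinOrder_eq_zpowers_of_isClosed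
    (isClosed_stabilizer_loop γ) (mt (stabilizer_loop_eq_top_iff γ).1 hγ)
  rw [h]
  exact ⟨finite_zpowers.2 hz, inferInstance⟩
end

section
/- Let F be a real inner product space and let f : ℝ → F be continuously differentiable. Then for every t ∈ [0,1], ‖f(t)‖² ≤ 2·∫₀¹ ‖f(u)‖² du + ∫₀¹ ‖f′(u)‖² du. (This is the quantitative form of the Sobolev embedding showing that curves of class H¹ on the circle are represented by continuous curves: the sup norm is controlled by the H¹ norm ⟨γ, γ⟩₁ = ∫ γ·γ + ∫ δγ·δγ.) -/
open MeasureTheory in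
/-- The increments of a continuously differentiable function `g` on `[0,1]` are bounded by the
integral of any continuous function dominating `|g′|`. -/
theorem sub_le_integral_of_abs_deriv_le {g g' h : ℝ → ℝ}
    (hg : ∀ u, HasDerivAt g (g' u) u) (hg' : Continuous g') (hh : Continuous h)
    (hle : ∀ u, |g' u| ≤ h u) {s t : ℝ}
    (hs : s ∈ Set.Icc (0 : ℝ) 1) (ht : t ∈ Set.Icc (0 : ℝ) 1) :
    g t - g s ≤ ∫ u in (0 : ℝ)..1, h u := by
  have hsub : Set.uIoc s t ⊆ Set.Ioc (0 : ℝ) 1 :=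
    Set.Ioc_subset_Ioc (le_min hs.1 ht.1) (max_le hs.2 ht.2)
  have h_int : IntegrableOn h (Set.Ioc (0 : ℝ) 1) := (hh.intervalIntegrable 0 1).1
  rw [← intervalIntegral.integral_eq_sub_of_hasDerivAt (fun u _ => hg u)
    (hg'.intervalIntegrable s t)]
  calc ∫ u in s..t, g' u ≤ ‖∫ u in s..t, g' u‖ := le_abs_self _
    _ ≤ ∫ u in Set.uIoc s t, ‖g' u‖ := intervalIntegral.norm_integral_le_integral_norm_uIoc
    _ ≤ ∫ u in Set.uIoc s t, h u :=
        setIntegral_mono (intervalIntegrable_iff.mp (hg'.intervalIntegrable s t)).norm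
          (h_int.mono_set hsub) hle
    _ ≤ ∫ u in Set.Ioc (0 : ℝ) 1, h u :=
        setIntegral_mono_set h_int
          (Filter.Eventually.of_forall fun u => (abs_nonneg _).trans (hle u)) hsub.eventuallyLE
    _ = ∫ u in (0 : ℝ)..1, h u := (intervalIntegral.integral_of_le zero_le_one).symm

/-- Quantitative Sobolev embedding `H¹ ↪ C⁰` on `[0,1]`: if `f : ℝ → F` is
continuously differentiable with values in a real inner product space, then for every
`t ∈ [0,1]`, `‖f t‖² ≤ 2·∫₀¹ ‖f u‖² du + ∫₀¹ ‖f′ u‖² du`. -/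
theorem sq_norm_le_two_mul_integral_add_integral_deriv
    {F : Type*} [NormedAddCommGroup F] [InnerProductSpace ℝ F]
    (f : ℝ → F) (hf : ContDiff ℝ 1 f) :
    ∀ t ∈ Set.Icc (0 : ℝ) 1,
      ‖f t‖ ^ 2 ≤ 2 * (∫ u in (0 : ℝ)..1, ‖f u‖ ^ 2) +
        ∫ u in (0 : ℝ)..1, ‖deriv f u‖ ^ 2 := by
  intro t ht
  have hc : Continuous f := hf.continuous
  have hc' : Continuous (deriv f) := hf.continuous_deriv le_rfl
  have hd : ∀ u, HasDerivAt (fun u => ‖f u‖ ^ 2) (2 * inner ℝ (f u) (deriv f u)) u :=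
    fun u => (hf.differentiable one_ne_zero u).hasDerivAt.norm_sq
  have hle : ∀ u, |2 * inner ℝ (f u) (deriv f u)| ≤ ‖f u‖ ^ 2 + ‖deriv f u‖ ^ 2 := by
    intro u
    rw [abs_mul, abs_two]
    nlinarith [abs_real_inner_le_norm (f u) (deriv f u), sq_nonneg (‖f u‖ - ‖deriv f u‖)]
  have hi : IntervalIntegrable (fun u => ‖f u‖ ^ 2) MeasureTheory.volume 0 1 :=
    (hc.norm.pow 2).intervalIntegrable 0 1
  have hi' : IntervalIntegrable (fun u => ‖deriv f u‖ ^ 2) MeasureTheory.volume 0 1 :=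
    (hc'.norm.pow 2).intervalIntegrable 0 1
  have hinc : ∀ s ∈ Set.Icc (0 : ℝ) 1, ‖f t‖ ^ 2 -
      ((∫ u in (0 : ℝ)..1, ‖f u‖ ^ 2) + ∫ u in (0 : ℝ)..1, ‖deriv f u‖ ^ 2) ≤ ‖f s‖ ^ 2 := by
    intro s hs
    have := sub_le_integral_of_abs_deriv_le hd (by fun_prop) (by fun_prop) hle hs ht
    rw [intervalIntegral.integral_add hi hi'] at this
    linarith
  have hmean := intervalIntegral.integral_mono_on zero_le_one
    intervalIntegrable_const hi hinc
  rw [intervalIntegral.integral_const, sub_zero, one_smul] at hmean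
  linarith
end

section
/- Let E be an infinite-dimensional real Hilbert space. Then the unit sphere S(E) = {x ∈ E : ‖x‖ = 1} is a contractible topological space. -/
open Metric unitInterval

/-- Two maps into the unit sphere of a normed space which are never antipodal are homotopic. -/
theorem ContinuousMap.homotopic_of_forall_ne_neg {X E : Type*} [TopologicalSpace X]
    [NormedAddCommGroup E] [NormedSpace ℝ E] (f g : C(X, sphere (0 : E) 1))
    (h : ∀ x, (f x : E) ≠ -(g x : E)) : f.Homotopic g := by
  have hne : ∀ p : I × X, (1 - (p.1 : ℝ)) • (f p.2 : E) + (p.1 : ℝ) • (g p.2 : E) ≠ 0 := by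
    rintro ⟨t, x⟩ h0
    have h1 : (1 - (t : ℝ)) • (f x : E) = -((t : ℝ) • (g x : E)) := eq_neg_of_add_eq_zero_left h0
    have h2 : 1 - (t : ℝ) = t := by
      simpa [norm_smul, abs_of_nonneg t.2.1, abs_of_nonneg (sub_nonneg.2 t.2.2)] using
        congrArg norm h1
    have ht : (t : ℝ) ≠ 0 := by intro h3; rw [h3] at h2; norm_num at h2
    rw [h2, ← smul_neg] at h1
    exact h x (smul_right_injective E ht h1)
  refine ⟨⟨⟨fun p ↦ ⟨‖(1 - (p.1 : ℝ)) • (f p.2 : E) + (p.1 : ℝ) • (g p.2 : E)‖⁻¹ •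
      ((1 - (p.1 : ℝ)) • (f p.2 : E) + (p.1 : ℝ) • (g p.2 : E)), ?_⟩, ?_⟩, ?_, ?_⟩⟩
  · rw [mem_sphere_zero_iff_norm, norm_smul, norm_inv, norm_norm,
      inv_mul_cancel₀ (norm_ne_zero_iff.2 (hne p))]
  · refine Continuous.subtype_mk (Continuous.smul (Continuous.inv₀ ?_ ?_) ?_) _
    · fun_prop
    · exact fun p ↦ norm_ne_zero_iff.2 (hne p)
    · fun_prop
  · intro x; ext; simp
  · intro x; ext; simp

/-- An infinite-dimensional real Hilbert space has a linear isometry without eigenvalue `-1`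
whose range is orthogonal to some unit vector. -/
theorem exists_linearIsometry_forall_ne_neg {E : Type*} [NormedAddCommGroup E]
    [InnerProductSpace ℝ E] [CompleteSpace E] (h : ¬ FiniteDimensional ℝ E) :
    ∃ (V : E →ₗᵢ[ℝ] E) (e : E), ‖e‖ = 1 ∧ (∀ x, inner ℝ e (V x) = 0) ∧
      ∀ x, x = -V x → x = 0 := by
  classical
  obtain ⟨w, b, -⟩ := exists_hilbertBasis ℝ E
  have hw : Infinite w := by
    by_contra hfin
    rw [not_infinite_iff_finite] at hfin
    have := Fintype.ofFinite w
    exact h (Module.Basis.finiteDimensional_of_finite b.toOrthonormalBasis.toBasis)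
  obtain ⟨φ⟩ : Nonempty (ℕ × w ≃ w) := by
    rw [← Cardinal.eq]
    simp
  let s : w → w := fun i ↦ φ ((φ.symm i).1 + 1, (φ.symm i).2)
  have hs : Function.Injective s := by
    intro i j hij
    have := φ.injective hij
    simp only [Prod.mk.injEq, add_left_inj] at this
    exact φ.symm.injective (Prod.ext this.1 this.2)
  have hbs : Orthonormal ℝ (b ∘ s) := b.orthonormal.comp s hs
  let V : E →ₗᵢ[ℝ] E :=
    hbs.orthogonalFamily.linearIsometry.comp b.repr.toLinearIsometry
  have hVb (i : w) : V (b i) = b (s i) := by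
    change hbs.orthogonalFamily.linearIsometry (b.repr (b i)) = _
    rw [b.repr_self, OrthogonalFamily.linearIsometry_apply_single]
    simp
  have hzero (i : w) (x : E) : inner ℝ (b (φ (0, i))) (V x) = 0 := by
    have hsum := (hbs.orthogonalFamily.hasSum_linearIsometry (b.repr x)).mapL
      (innerSL ℝ (b (φ (0, i))))
    refine hsum.unique ?_
    convert! hasSum_zero using 2 with j
    have hne : φ (0, i) ≠ s j := by
      intro hij
      simpa using φ.injective hij
    simp [b.orthonormal.2 hne]
  have hsucc (n : ℕ) (i : w) (x : E) :
      inner ℝ (b (φ (n + 1, i))) (V x) = inner ℝ (b (φ (n, i))) x := by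
    rw [← V.inner_map_map (b (φ (n, i))) x, hVb]
    simp [s]
  obtain ⟨i₀⟩ := (inferInstance : Nonempty w)
  refine ⟨V, b (φ (0, i₀)), b.orthonormal.1 _, hzero i₀, fun x hx ↦ ?_⟩
  have hcoef (n : ℕ) (i : w) : inner ℝ (b (φ (n, i))) x = 0 := by
    induction n with
    | zero => rw [hx, inner_neg_right, hzero, neg_zero]
    | succ n ih => rw [hx, inner_neg_right, hsucc, ih, neg_zero]
  refine b.repr.map_eq_zero_iff.1 (lp.ext (funext fun j ↦ ?_))
  rw [b.repr_apply_apply, ← φ.apply_symm_apply j]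
  exact hcoef _ _

/-- The unit sphere of an infinite-dimensional real Hilbert space is contractible. -/
theorem contractible_unit_sphere_of_infinite_dimensional
    {E : Type*} [NormedAddCommGroup E] [InnerProductSpace ℝ E] [CompleteSpace E]
    (h : ¬ FiniteDimensional ℝ E) :
    ContractibleSpace (Metric.sphere (0 : E) 1) := by
  obtain ⟨V, e, he, horth, hV⟩ := exists_linearIsometry_forall_ne_neg h
  rw [contractible_iff_id_nullhomotopic]
  let F : C(sphere (0 : E) 1, sphere (0 : E) 1) :=
    ⟨fun x ↦ ⟨V x, by simp⟩, by fun_prop⟩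
  refine ⟨⟨e, by simpa using he⟩, ContinuousMap.Homotopic.trans (g := F) ?_ ?_⟩
  · refine ContinuousMap.homotopic_of_forall_ne_neg _ _ fun x hx ↦ ?_
    exact ne_zero_of_mem_unit_sphere x (hV x hx)
  · refine ContinuousMap.homotopic_of_forall_ne_neg _ _ fun x hx ↦ ?_
    have hVx : V x = -e := hx
    have := horth x
    rw [hVx, inner_neg_right, real_inner_self_eq_norm_sq, he] at this
    norm_num at this
end
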